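/- arXiv:2002.00564 — 5 statements merged into one kernel-verified Lean document; each statement's English description precedes it below -/
import Mathlib

section
/- For every real number θ, the integral −∫₀^θ log|2 sin t| dt converges and equals (1/2)·∑_{n=1}^∞ sin(2nθ)/n². In other words, the Lobachevsky function Λ(θ) = −∫₀^θ log|2 sin t| dt coincides with its Fourier series (1/2)∑_{n=1}^∞ sin(2nθ)/n² for all θ ∈ ℝ. -/
open MeasureTheory Real

open Filter Topology

lemma intervalIntegrable_log_abs_two_mul_sin (a b : ℝ) :
    IntervalIntegrable (fun t : ℝ => Real.log |2 * Real.sin t|) volume a b := by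
  have h : AnalyticOnNhd ℝ (fun t : ℝ => 2 * Real.sin t) (Set.uIcc a b) :=
    fun x _ => analyticAt_const.mul Real.analyticAt_sin
  exact h.meromorphicOn.intervalIntegrable_log_norm

lemma intervalIntegrable_log_abs_sin_two_mul (a b : ℝ) :
    IntervalIntegrable (fun t : ℝ => Real.log |Real.sin (2 * t)|) volume a b := by
  have h : AnalyticOnNhd ℝ (fun t : ℝ => Real.sin (2 * t)) (Set.uIcc a b) :=
    fun x _ => Real.analyticAt_sin.comp (analyticAt_const.mul analyticAt_id)
  exact h.meromorphicOn.intervalIntegrable_log_norm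

lemma ae_sin_two_mul_ne_zero : ∀ᵐ t : ℝ, Real.sin (2 * t) ≠ 0 := by
  have h : {t : ℝ | Real.sin (2 * t) = 0} ⊆ Set.range fun n : ℤ => (n : ℝ) * π / 2 := by
    intro t ht
    obtain ⟨n, hn⟩ := Real.sin_eq_zero_iff.1 ht
    exact ⟨n, by simp only [hn]; ring⟩
  simpa [ae_iff] using ((Set.countable_range _).mono h).measure_zero volume

lemma norm_sq_one_sub_mul_exp (r t : ℝ) :
    ‖(1 : ℂ) - r * Complex.exp ((2 * t : ℝ) * Complex.I)‖ ^ 2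
      = (Real.cos (2 * t) - r) ^ 2 + Real.sin (2 * t) ^ 2 := by
  rw [Complex.sq_norm, Complex.normSq_apply]
  simp only [Complex.sub_re, Complex.sub_im, Complex.re_ofReal_mul, Complex.im_ofReal_mul,
    Complex.exp_ofReal_mul_I_re, Complex.exp_ofReal_mul_I_im, Complex.one_re, Complex.one_im]
  linear_combination (r ^ 2 - 1) * Real.sin_sq_add_cos_sq (2 * t)

lemma abs_sin_le_norm_one_sub_mul_exp (r t : ℝ) :
    |Real.sin (2 * t)| ≤ ‖(1 : ℂ) - r * Complex.exp ((2 * t : ℝ) * Complex.I)‖ := by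
  refine abs_le_of_sq_le_sq ?_ (norm_nonneg _)
  rw [norm_sq_one_sub_mul_exp]
  nlinarith [sq_nonneg (Real.cos (2 * t) - r)]

lemma norm_one_sub_exp (t : ℝ) :
    ‖(1 : ℂ) - (1 : ℝ) * Complex.exp ((2 * t : ℝ) * Complex.I)‖ = |2 * Real.sin t| := by
  rw [← sq_eq_sq₀ (norm_nonneg _) (abs_nonneg _), norm_sq_one_sub_mul_exp, sq_abs,
    Real.sin_two_mul, Real.cos_two_mul]
  have h := Real.sin_sq_add_cos_sq t
  have h' : Real.cos t ^ 2 = 1 - Real.sin t ^ 2 := by linarith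
  rw [mul_pow, mul_pow, h']
  ring

lemma norm_ofReal_mul_exp {r : ℝ} (hr : 0 ≤ r) (t : ℝ) :
    ‖(r : ℂ) * Complex.exp ((2 * t : ℝ) * Complex.I)‖ = r := by
  rw [norm_mul, Complex.norm_exp_ofReal_mul_I, mul_one, Complex.norm_of_nonneg hr]

lemma hasSum_log_norm_one_sub_mul_exp {r : ℝ} (h0 : 0 ≤ r) (h1 : r < 1) (t : ℝ) :
    HasSum (fun n : ℕ => r ^ n * Real.cos (2 * n * t) / n)
      (-Real.log ‖(1 : ℂ) - r * Complex.exp ((2 * t : ℝ) * Complex.I)‖) := by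
  have h := Complex.hasSum_re
    (Complex.hasSum_taylorSeries_neg_log ((norm_ofReal_mul_exp h0 t).trans_lt h1))
  rw [Complex.neg_re, Complex.log_re] at h
  convert h using 2 with n
  rw [mul_pow, ← Complex.exp_nat_mul,
    show (n : ℂ) * ((2 * t : ℝ) * Complex.I) = ((2 * n * t : ℝ) : ℂ) * Complex.I by
      push_cast; ring, Complex.div_natCast_re, ← Complex.ofReal_pow, Complex.re_ofReal_mul,
    Complex.exp_ofReal_mul_I_re]

lemma integral_cos_two_mul_natCast_mul (n : ℕ) (r θ : ℝ) :
    ∫ t in (0 : ℝ)..θ, r ^ n * Real.cos (2 * n * t) / n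
      = r ^ n * (Real.sin (2 * n * θ) / (n : ℝ) ^ 2) / 2 := by
  rcases eq_or_ne n 0 with rfl | hn
  · simp
  have hn' : (n : ℝ) ≠ 0 := Nat.cast_ne_zero.2 hn
  rw [intervalIntegral.integral_div, intervalIntegral.integral_const_mul,
    intervalIntegral.integral_comp_mul_left (fun x => Real.cos x) (by positivity)]
  simp
  field_simp

lemma hasSum_integral_log_norm_one_sub_mul_exp {r : ℝ} (h0 : 0 ≤ r) (h1 : r < 1) (θ : ℝ) :
    HasSum (fun n : ℕ => r ^ n * (Real.sin (2 * n * θ) / (n : ℝ) ^ 2) / 2)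
      (∫ t in (0 : ℝ)..θ,
        -Real.log ‖(1 : ℂ) - r * Complex.exp ((2 * t : ℝ) * Complex.I)‖) := by
  simp_rw [← integral_cos_two_mul_natCast_mul]
  refine intervalIntegral.hasSum_integral_of_dominated_convergence (fun n _ => r ^ n)
    (fun n => ?_) (fun n => ?_) ?_ ?_ ?_
  · exact Continuous.aestronglyMeasurable (by fun_prop)
  · refine .of_forall fun t _ => ?_
    rw [mul_div_assoc, norm_mul, norm_pow, Real.norm_of_nonneg h0, norm_div, RCLike.norm_natCast]
    refine mul_le_of_le_one_right (by positivity) ?_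
    rcases Nat.eq_zero_or_pos n with rfl | hn
    · simp
    · have hn' : (1 : ℝ) ≤ n := Nat.one_le_cast.2 hn
      exact div_le_one_of_le₀ ((Real.abs_cos_le_one _).trans hn') (by positivity)
  · exact .of_forall fun _ _ => summable_geometric_of_lt_one h0 h1
  · exact intervalIntegrable_const
  · exact .of_forall fun t _ => hasSum_log_norm_one_sub_mul_exp h0 h1 t

lemma tendsto_integral_log_norm_one_sub_mul_exp (θ : ℝ) :
    Tendsto (fun r : ℝ => ∫ t in (0 : ℝ)..θ,
        -Real.log ‖(1 : ℂ) - r * Complex.exp ((2 * t : ℝ) * Complex.I)‖) (𝓝[<] 1)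
      (𝓝 (∫ t in (0 : ℝ)..θ, -Real.log |2 * Real.sin t|)) := by
  refine intervalIntegral.tendsto_integral_filter_of_dominated_convergence
    (fun t => Real.log 2 + |(Real.log |Real.sin (2 * t)|)|) ?_ ?_ ?_ ?_
  · exact .of_forall fun r => (by fun_prop : Measurable _).aestronglyMeasurable
  · filter_upwards [Ioo_mem_nhdsLT (zero_lt_one' ℝ)] with r hr
    filter_upwards [ae_sin_two_mul_ne_zero] with t ht _
    have hs := abs_pos.2 ht
    have hlow := abs_sin_le_norm_one_sub_mul_exp r t
    have hup : ‖(1 : ℂ) - r * Complex.exp ((2 * t : ℝ) * Complex.I)‖ ≤ 2 := by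
      refine (norm_sub_le _ _).trans ?_
      rw [norm_ofReal_mul_exp hr.1.le, norm_one]
      linarith [hr.2]
    have hl := Real.log_le_log hs hlow
    have hu := Real.log_le_log (hs.trans_le hlow) hup
    have hlog2 : 0 < Real.log 2 := Real.log_pos one_lt_two
    rw [norm_neg, Real.norm_eq_abs, abs_le]
    constructor
    · linarith [neg_abs_le (Real.log |Real.sin (2 * t)|)]
    · linarith [abs_nonneg (Real.log |Real.sin (2 * t)|)]
  · exact intervalIntegrable_const.add (intervalIntegrable_log_abs_sin_two_mul 0 θ).abs
  · filter_upwards [ae_sin_two_mul_ne_zero] with t ht _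
    rw [← norm_one_sub_exp]
    have hne : ‖(1 : ℂ) - (1 : ℝ) * Complex.exp ((2 * t : ℝ) * Complex.I)‖ ≠ 0 :=
      ((abs_pos.2 ht).trans_le (abs_sin_le_norm_one_sub_mul_exp 1 t)).ne'
    have hc : Continuous fun r : ℝ =>
        ‖(1 : ℂ) - r * Complex.exp ((2 * t : ℝ) * Complex.I)‖ := by fun_prop
    exact ((hc.continuousAt (x := 1)).log hne).neg.tendsto.mono_left nhdsWithin_le_nhds

lemma tendsto_tsum_pow_mul_sin_div_sq (θ : ℝ) :
    Tendsto (fun r : ℝ => ∑' n : ℕ, r ^ n * (Real.sin (2 * n * θ) / (n : ℝ) ^ 2) / 2) (𝓝[<] 1)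
      (𝓝 (∑' n : ℕ, Real.sin (2 * n * θ) / (n : ℝ) ^ 2 / 2)) := by
  refine tendsto_tsum_of_dominated_convergence (bound := fun n : ℕ => 1 / (n : ℝ) ^ 2)
    (Real.summable_one_div_nat_pow.2 one_lt_two) (fun n => ?_) ?_
  · have hc : Continuous fun r : ℝ => r ^ n * (Real.sin (2 * n * θ) / (n : ℝ) ^ 2) / 2 := by
      fun_prop
    simpa using (hc.tendsto 1).mono_left nhdsWithin_le_nhds
  · filter_upwards [Ioo_mem_nhdsLT (zero_lt_one' ℝ)] with r hr n
    have hsin : ‖Real.sin (2 * n * θ) / (n : ℝ) ^ 2‖ ≤ 1 / (n : ℝ) ^ 2 := by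
      rw [norm_div, norm_pow, RCLike.norm_natCast]
      gcongr
      exact Real.abs_sin_le_one _
    have hpow : ‖r ^ n‖ ≤ 1 := by
      rw [norm_pow, Real.norm_of_nonneg hr.1.le]
      exact pow_le_one₀ hr.1.le hr.2.le
    rw [norm_div, norm_mul, Real.norm_two]
    have := mul_le_of_le_one_left (norm_nonneg (Real.sin (2 * n * θ) / (n : ℝ) ^ 2)) hpow
    linarith [mul_nonneg (norm_nonneg (r ^ n)) (norm_nonneg (Real.sin (2 * n * θ) / (n : ℝ) ^ 2))]

/-- The Lobachevsky function `Λ(θ) = −∫₀^θ log|2 sin t| dt` is a convergent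
(improper) integral for every real `θ`, and it coincides with its Fourier series
`(1/2)·∑_{n=1}^∞ sin(2nθ)/n²`. -/
theorem lobachevsky_eq_fourier_series (θ : ℝ) :
    IntervalIntegrable (fun t : ℝ => Real.log |2 * Real.sin t|) volume 0 θ ∧
    -(∫ t in (0:ℝ)..θ, Real.log |2 * Real.sin t|) =
      (1 / 2) * ∑' n : ℕ+, Real.sin (2 * (n : ℝ) * θ) / (n : ℝ) ^ 2 := by
  refine ⟨intervalIntegrable_log_abs_two_mul_sin 0 θ, ?_⟩
  have hsum : ∑' n : ℕ+, Real.sin (2 * (n : ℝ) * θ) / (n : ℝ) ^ 2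
      = ∑' n : ℕ, Real.sin (2 * n * θ) / (n : ℝ) ^ 2 :=
    tsum_subtype_eq_of_support_subset (f := fun n : ℕ => Real.sin (2 * n * θ) / (n : ℝ) ^ 2)
      fun n hn => Nat.pos_of_ne_zero fun h => hn (by simp [h])
  rw [hsum, ← intervalIntegral.integral_neg, one_div_mul_eq_div, ← tsum_div_const]
  refine tendsto_nhds_unique (tendsto_integral_log_norm_one_sub_mul_exp θ)
    ((tendsto_tsum_pow_mul_sin_div_sq θ).congr' ?_)
  filter_upwards [Ioo_mem_nhdsLT (zero_lt_one' ℝ)] with r hr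
  exact (hasSum_integral_log_norm_one_sub_mul_exp hr.1.le hr.2 θ).tsum_eq
end

section
/- Let A be an element of SL(2,ℂ) with A ≠ I and A ≠ −I whose trace equals 2 or −2 (so the image of A in PSL(2,ℂ) is a nontrivial parabolic element). Then the centralizer in PSL(2,ℂ) of the image of A is isomorphic, as an abstract group, to the additive group (ℂ, +) of complex numbers. -/
/-- `SL(2,ℂ)`. -/
abbrev SL2C := Matrix.SpecialLinearGroup (Fin 2) ℂ

/-- `PSL(2,ℂ) = SL(2,ℂ)/{±I}`, the quotient of `SL(2,ℂ)` by its center. -/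
abbrev PSL2C := SL2C ⧸ Subgroup.center SL2C

namespace Matrix

variable {R K : Type*} [CommRing R] [Field K]

/-- The one-parameter group `t ↦ 1 + t N` attached to a `2 × 2` matrix `N` with vanishing
trace and determinant. -/
def unipotentHom (N : Matrix (Fin 2) (Fin 2) R) (htr : N.trace = 0) (hdet : N.det = 0) :
    Multiplicative R →* SpecialLinearGroup (Fin 2) R where
  toFun t := ⟨1 + t.toAdd • N, by
    rw [trace_fin_two] at htr
    rw [det_fin_two] at hdet ⊢
    simp
    linear_combination t.toAdd * htr + t.toAdd ^ 2 * hdet⟩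
  map_one' := by ext; simp
  map_mul' s t := by
    have hN : N * N = 0 := by
      rw [trace_fin_two] at htr
      rw [det_fin_two] at hdet
      ext i j
      fin_cases i <;> fin_cases j <;> simp [mul_apply, Fin.sum_univ_two]
      · linear_combination N 0 0 * htr - hdet
      · linear_combination N 0 1 * htr
      · linear_combination N 1 0 * htr
      · linear_combination N 1 1 * htr - hdet
    apply Subtype.ext
    change 1 + (s.toAdd + t.toAdd) • N = (1 + s.toAdd • N) * (1 + t.toAdd • N)
    simp only [mul_add, add_mul, one_mul, mul_one,
      smul_mul_assoc, mul_smul_comm, hN, smul_zero, add_smul, add_zero]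
    abel

@[simp]
lemma coe_unipotentHom (N : Matrix (Fin 2) (Fin 2) R) (htr : N.trace = 0) (hdet : N.det = 0)
    (t : Multiplicative R) :
    (unipotentHom N htr hdet t : Matrix (Fin 2) (Fin 2) R) = 1 + t.toAdd • N :=
  rfl

/-- A matrix commuting with a nonzero `2 × 2` matrix `N` with vanishing trace and determinant
is a combination of `1` and `N`. -/
lemma exists_eq_smul_one_add_smul_of_commute {N B : Matrix (Fin 2) (Fin 2) K} (hN : N ≠ 0)
    (htr : N.trace = 0) (hdet : N.det = 0) (h : Commute B N) :
    ∃ x y : K, B = x • (1 : Matrix (Fin 2) (Fin 2) K) + y • N := by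
  rw [trace_fin_two] at htr
  rw [det_fin_two] at hdet
  have h00 := congrFun (congrFun h.eq 0) 0
  have h01 := congrFun (congrFun h.eq 0) 1
  have h10 := congrFun (congrFun h.eq 1) 0
  simp only [mul_apply, Fin.sum_univ_two] at h00 h01 h10
  by_cases hq : N 0 1 = 0
  · have hr : N 1 0 ≠ 0 := by
      intro hr
      have h0 : N 0 0 = 0 := by
        have : N 0 0 ^ 2 = 0 := by linear_combination N 0 0 * htr - hdet - N 0 1 * hr
        exact pow_eq_zero_iff two_ne_zero |>.mp this
      have h1 : N 1 1 = 0 := by linear_combination htr - h0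
      exact hN (by ext i j; fin_cases i <;> fin_cases j <;> assumption)
    refine ⟨B 0 0 - B 1 0 / N 1 0 * N 0 0, B 1 0 / N 1 0, ?_⟩
    ext i j
    fin_cases i <;> fin_cases j <;> simp <;> field_simp
    · linear_combination h00
    · linear_combination h10
  · refine ⟨B 0 0 - B 0 1 / N 0 1 * N 0 0, B 0 1 / N 0 1, ?_⟩
    ext i j
    fin_cases i <;> fin_cases j <;> simp <;> field_simp
    · linear_combination -h00
    · linear_combination -h01

end Matrix

namespace Matrix.SpecialLinearGroup

variable {K : Type*} [Field K]

lemma mem_center_fin_two_iff {A : SpecialLinearGroup (Fin 2) K} :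
    A ∈ Subgroup.center (SpecialLinearGroup (Fin 2) K) ↔ A = 1 ∨ A = -1 := by
  rw [mem_center_iff]
  constructor
  · rintro ⟨r, hr, h⟩
    rw [Fintype.card_fin, sq_eq_one_iff] at hr
    rcases hr with rfl | rfl
    · left
      apply Subtype.ext
      rw [← h, coe_one, map_one]
    · right
      apply Subtype.ext
      rw [← h, coe_neg, coe_one, map_neg, map_one]
  · rintro (rfl | rfl)
    · exact ⟨1, by simp, by simp⟩
    · exact ⟨-1, by simp, by rw [coe_neg, coe_one, map_neg, map_one]⟩

/-- Two elements of `SL(2, K)` have the same image in `PSL(2, K)` iff they agree up to sign. -/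
lemma mk_center_eq_mk_iff {A B : SpecialLinearGroup (Fin 2) K} :
    (A : SpecialLinearGroup (Fin 2) K ⧸ Subgroup.center (SpecialLinearGroup (Fin 2) K)) = B ↔
      B = A ∨ B = -A := by
  rw [QuotientGroup.eq, mem_center_fin_two_iff, inv_mul_eq_iff_eq_mul, inv_mul_eq_iff_eq_mul,
    mul_one, mul_neg_one]

/-- Commuting with the image of `A` in `PSL(2, K)` amounts to commuting with `A` as soon as
`A` has nonzero trace and `2 ≠ 0`. -/
lemma mk_center_mem_centralizer_iff (h2 : (2 : K) ≠ 0) {A B : SpecialLinearGroup (Fin 2) K}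
    (hA : (A : Matrix (Fin 2) (Fin 2) K).trace ≠ 0) :
    (B : SpecialLinearGroup (Fin 2) K ⧸ Subgroup.center (SpecialLinearGroup (Fin 2) K)) ∈
      Subgroup.centralizer {(A : SpecialLinearGroup (Fin 2) K ⧸
        Subgroup.center (SpecialLinearGroup (Fin 2) K))} ↔ Commute B A := by
  rw [Subgroup.mem_centralizer_singleton_iff, ← QuotientGroup.mk_mul, ← QuotientGroup.mk_mul,
    mk_center_eq_mk_iff]
  refine ⟨?_, fun h ↦ .inl h.eq.symm⟩
  rintro (h | h)
  · exact h.symm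
  · have hconj : A = -(B * A * B⁻¹) := by
      rw [← neg_mul, ← h, mul_inv_cancel_right]
    have htr : (A : Matrix (Fin 2) (Fin 2) K).trace = -(A : Matrix (Fin 2) (Fin 2) K).trace := by
      conv_lhs => rw [hconj]
      rw [coe_neg, trace_neg, coe_mul, trace_mul_comm, ← coe_mul, inv_mul_cancel_left]
    refine absurd ?_ (mul_ne_zero h2 hA)
    linear_combination htr

/-- The centralizer in `PSL(2, K)` of the image of a nontrivial unipotent element is isomorphic
to the additive group of `K`. -/
theorem nonempty_centralizer_mulEquiv_of_trace_eq_two (h2 : (2 : K) ≠ 0)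
    {A : SpecialLinearGroup (Fin 2) K} (hA : A ≠ 1)
    (htr : (A : Matrix (Fin 2) (Fin 2) K).trace = 2) :
    Nonempty (Subgroup.centralizer {(A : SpecialLinearGroup (Fin 2) K ⧸
      Subgroup.center (SpecialLinearGroup (Fin 2) K))} ≃* Multiplicative K) := by
  set N : Matrix (Fin 2) (Fin 2) K := A - 1 with hNdef
  have hAN : (A : Matrix (Fin 2) (Fin 2) K) = 1 + N := by simp [hNdef]
  have hN : N ≠ 0 := fun h ↦ hA (Subtype.ext (by simpa [h] using hAN))
  have hNtr : N.trace = 0 := by simp [hNdef, htr]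
  have hNdet : N.det = 0 := by
    have hdet := A.det_coe
    rw [trace_fin_two] at htr
    rw [det_fin_two] at hdet ⊢
    simp [hNdef]
    linear_combination hdet - htr
  have hA0 : (A : Matrix (Fin 2) (Fin 2) K).trace ≠ 0 := htr ▸ h2
  have hA1 : A = unipotentHom N hNtr hNdet (.ofAdd 1) := Subtype.ext (by simp [hAN])
  refine ⟨(MulEquiv.ofBijective (((QuotientGroup.mk' _).comp
    (unipotentHom N hNtr hNdet)).codRestrict _ fun t ↦ ?_) ⟨?_, ?_⟩).symm⟩
  · refine (mk_center_mem_centralizer_iff h2 hA0).mpr ?_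
    rw [hA1]
    exact (Commute.all t _).map _
  · rw [injective_iff_map_eq_one]
    intro t ht
    have hmem : unipotentHom N hNtr hNdet t = 1 ∨ unipotentHom N hNtr hNdet t = -1 :=
      mem_center_fin_two_iff.mp ((QuotientGroup.eq_one_iff _).mp (congrArg Subtype.val ht))
    rcases hmem with h | h
    · have h' := congrArg Subtype.val h
      rw [coe_unipotentHom, coe_one, add_eq_left, smul_eq_zero_iff_left hN] at h'
      exact h'
    · have h' := congrArg (fun B : SpecialLinearGroup (Fin 2) K ↦ (B : Matrix (Fin 2) (Fin 2) K).trace) h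
      simp [hNtr] at h'
      refine absurd ?_ (mul_ne_zero h2 h2)
      linear_combination h'
  · rintro ⟨b, hb⟩
    obtain ⟨B, rfl⟩ := QuotientGroup.mk_surjective b
    have hcomm : Commute (B : Matrix (Fin 2) (Fin 2) K) N := by
      refine Commute.sub_right ?_ (Commute.one_right _)
      exact congrArg Subtype.val ((mk_center_mem_centralizer_iff h2 hA0).mp hb).eq
    obtain ⟨x, y, hxy⟩ := exists_eq_smul_one_add_smul_of_commute hN hNtr hNdet hcomm
    have hx : x = 1 ∨ x = -1 := by
      have hdet := B.det_coe
      rw [trace_fin_two] at hNtr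
      rw [hxy, det_fin_two] at hdet
      rw [det_fin_two] at hNdet
      simp at hdet
      rw [← sq_eq_one_iff]
      linear_combination hdet - x * y * hNtr - y ^ 2 * hNdet
    refine ⟨.ofAdd (x * y), Subtype.ext (mk_center_eq_mk_iff.mpr ?_)⟩
    rcases hx with rfl | rfl
    · exact .inl (Subtype.ext (by simp [hxy]))
    · exact .inr (Subtype.ext (by simp [hxy, -ofAdd_neg, add_comm]))

end Matrix.SpecialLinearGroup

/-- If `A ∈ SL(2,ℂ)`, `A ≠ ±I`, has trace `2` or `−2` (so its image in `PSL(2,ℂ)` is a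
nontrivial parabolic element), then the centralizer of the image of `A` in `PSL(2,ℂ)`
is isomorphic, as an abstract group, to the additive group `(ℂ, +)`. -/
theorem centralizer_of_parabolic (A : SL2C) (hA : A ≠ 1) (hA' : A ≠ -1)
    (htr : Matrix.trace (A : Matrix (Fin 2) (Fin 2) ℂ) = 2 ∨
      Matrix.trace (A : Matrix (Fin 2) (Fin 2) ℂ) = -2) :
    Nonempty
      ((Subgroup.centralizer {(QuotientGroup.mk A : PSL2C)}) ≃* Multiplicative ℂ) := by
  rcases htr with htr | htr
  · exact Matrix.SpecialLinearGroup.nonempty_centralizer_mulEquiv_of_trace_eq_two two_ne_zero hA htr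
  · have hneg : (QuotientGroup.mk A : PSL2C) = QuotientGroup.mk (-A) :=
      Matrix.SpecialLinearGroup.mk_center_eq_mk_iff.mpr (.inr rfl)
    rw [hneg]
    refine Matrix.SpecialLinearGroup.nonempty_centralizer_mulEquiv_of_trace_eq_two two_ne_zero
      (fun h ↦ hA' (neg_eq_iff_eq_neg.mp h)) ?_
    rw [Matrix.SpecialLinearGroup.coe_neg, Matrix.trace_neg, htr, neg_neg]
end

section
/- Let Γ be a commutative subgroup of PSL(2,ℂ) that is torsion-free, i.e., every nontrivial element of Γ has infinite order. Then Γ is conjugate in PSL(2,ℂ) either into the image in PSL(2,ℂ) of the subgroup of diagonal matrices of SL(2,ℂ), or into the image in PSL(2,ℂ) of the subgroup of upper unitriangular matrices {[[1,b],[0,1]] : b ∈ ℂ}. (Equivalently: either all nontrivial elements of Γ are elliptic/hyperbolic sharing a common pair of fixed points on ∂ℍ³, or all nontrivial elements are parabolic sharing a common fixed point.) -/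
/-- A central element of `SL(2,ℂ)` is `1` or `-1`. -/
theorem SL2C.eq_one_or_neg_one_of_mem_center {z : SL2C} (hz : z ∈ Subgroup.center SL2C) :
    z = 1 ∨ z = -1 := by
  obtain ⟨r, hr, h⟩ := Matrix.SpecialLinearGroup.mem_center_iff.mp hz
  rw [Fintype.card_fin, sq_eq_one_iff] at hr
  rcases hr with rfl | rfl
  · left
    apply Subtype.ext
    rw [← h]
    simp
  · right
    apply Subtype.ext
    rw [← h]
    simp [← Matrix.diagonal_one, Matrix.diagonal_neg]

theorem SL2C.neg_one_mem_center : (-1 : SL2C) ∈ Subgroup.center SL2C :=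
  Subgroup.mem_center_iff.mpr fun g => by simp

theorem SL2C.mk_neg (A : SL2C) : (QuotientGroup.mk (-A) : PSL2C) = QuotientGroup.mk A := by
  rw [QuotientGroup.eq]
  have h : (-A)⁻¹ * A = -1 := by
    rw [inv_mul_eq_iff_eq_mul]
    simp
  rw [h]
  exact SL2C.neg_one_mem_center

theorem SL2C.det_expand (A : SL2C) : A 0 0 * A 1 1 - A 0 1 * A 1 0 = 1 := by
  rw [← Matrix.det_fin_two]
  exact A.det_coe

/-- A scalar matrix of `SL(2,ℂ)` is `1` or `-1`. -/
theorem SL2C.eq_one_or_neg_one_of_scalar {A : SL2C} (h01 : A 0 1 = 0) (h10 : A 1 0 = 0)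
    (h : A 0 0 = A 1 1) : A = 1 ∨ A = -1 := by
  have hd := SL2C.det_expand A
  have h1 : A 1 1 ^ 2 = 1 := by
    rw [h01, h] at hd
    linear_combination hd
  rcases sq_eq_one_iff.mp h1 with h1 | h1
  · left
    ext i j
    fin_cases i <;> fin_cases j <;> simp [h01, h10, h, h1]
  · right
    ext i j
    fin_cases i <;> fin_cases j <;> simp [h01, h10, h, h1]

/-- A traceless matrix of `SL(2,ℂ)` squares to `-1`. -/
theorem SL2C.sq_eq_neg_one_of_trace_eq_zero {A : SL2C} (h : A 0 0 + A 1 1 = 0) :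
    A ^ 2 = -1 := by
  have hd := SL2C.det_expand A
  have h' : A 1 1 = -A 0 0 := by linear_combination h
  rw [h'] at hd
  ext i j
  fin_cases i <;> fin_cases j <;> simp [pow_two, Matrix.mul_apply, Fin.sum_univ_two, h']
  · linear_combination -hd
  · ring
  · ring
  · linear_combination -hd

/-- If the classes of `A` and `B` commute in `PSL(2,ℂ)` and the class of `A` is trivial or of
infinite order, then `A` and `B` commute in `SL(2,ℂ)`. -/
theorem SL2C.commute_of_commute_mk {A B : SL2C}
    (hcomm : (QuotientGroup.mk A : PSL2C) * QuotientGroup.mk B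
      = QuotientGroup.mk B * QuotientGroup.mk A)
    (htf : (QuotientGroup.mk A : PSL2C) ≠ 1 → ¬ IsOfFinOrder (QuotientGroup.mk A : PSL2C)) :
    Commute A B := by
  by_cases hA : (QuotientGroup.mk A : PSL2C) = 1
  · rw [QuotientGroup.eq_one_iff] at hA
    exact (Subgroup.mem_center_iff.mp hA B).symm
  rw [← QuotientGroup.mk_mul, ← QuotientGroup.mk_mul, QuotientGroup.eq] at hcomm
  rcases SL2C.eq_one_or_neg_one_of_mem_center hcomm with h | h
  · rw [inv_mul_eq_iff_eq_mul, mul_one] at h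
    exact h.symm
  · exfalso
    rw [inv_mul_eq_iff_eq_mul, mul_neg, mul_one] at h
    have hconj : B * A * B⁻¹ = -A := by
      rw [h, neg_mul, mul_inv_cancel_right]
    have htr : Matrix.trace (A : Matrix (Fin 2) (Fin 2) ℂ) = -Matrix.trace A.1 := by
      have h2 := congrArg (fun X : SL2C => Matrix.trace X.1) hconj
      simp only [Matrix.SpecialLinearGroup.coe_mul, Matrix.SpecialLinearGroup.coe_neg,
        Matrix.trace_neg] at h2
      rw [← h2, Matrix.trace_mul_comm, ← mul_assoc, ← Matrix.SpecialLinearGroup.coe_mul]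
      simp
    rw [Matrix.trace_fin_two] at htr
    have hsq := SL2C.sq_eq_neg_one_of_trace_eq_zero (A := A) (by linear_combination htr / 2)
    refine htf hA (isOfFinOrder_iff_pow_eq_one.mpr ⟨2, two_pos, ?_⟩)
    rw [← QuotientGroup.mk_pow, hsq, SL2C.mk_neg]
    rfl

theorem SL2C.conj_apply_one_zero (Q M : SL2C) : (Q * M * Q⁻¹) 1 0 =
    (Q 1 0 * M 0 0 + Q 1 1 * M 1 0) * Q 1 1 - (Q 1 0 * M 0 1 + Q 1 1 * M 1 1) * Q 1 0 := by
  rw [Matrix.SpecialLinearGroup.coe_mul, Matrix.SpecialLinearGroup.coe_mul,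
    Matrix.SpecialLinearGroup.coe_inv, Matrix.adjugate_fin_two]
  simp [Matrix.mul_apply, Fin.sum_univ_two]
  ring

theorem SL2C.conj_apply_zero_one (Q M : SL2C) : (Q * M * Q⁻¹) 0 1 =
    (Q 0 0 * M 0 1 + Q 0 1 * M 1 1) * Q 0 0 - (Q 0 0 * M 0 0 + Q 0 1 * M 1 0) * Q 0 1 := by
  rw [Matrix.SpecialLinearGroup.coe_mul, Matrix.SpecialLinearGroup.coe_mul,
    Matrix.SpecialLinearGroup.coe_inv, Matrix.adjugate_fin_two]
  simp [Matrix.mul_apply, Fin.sum_univ_two]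
  ring

/-- Every matrix of `SL(2,ℂ)` is conjugate to an upper triangular one. -/
theorem SL2C.exists_conj_upper_triangular (M : SL2C) :
    ∃ P : SL2C, (P * M * P⁻¹) 1 0 = 0 := by
  by_cases hc : M 1 0 = 0
  · exact ⟨1, by simpa using hc⟩
  obtain ⟨s, hs⟩ := IsAlgClosed.exists_pow_nat_eq ((M 0 0 + M 1 1) ^ 2 - 4) two_pos
  have hd := SL2C.det_expand M
  let P : SL2C := ⟨!![0, 1 / M 1 0; -M 1 0, (M 0 0 + M 1 1 + s) / 2 - M 1 1], by
    simp [Matrix.det_fin_two_of, hc]⟩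
  refine ⟨P, ?_⟩
  rw [SL2C.conj_apply_one_zero]
  simp [P]
  linear_combination M 1 0 * (hs / 4 + hd)

/-- Every matrix of `SL(2,ℂ)` is conjugate to a diagonal one or to an upper triangular one with
equal diagonal entries. -/
theorem SL2C.exists_conj_diagonal_or_parabolic (M : SL2C) :
    ∃ P : SL2C, (P * M * P⁻¹) 1 0 = 0 ∧
      ((P * M * P⁻¹) 0 1 = 0 ∨ (P * M * P⁻¹) 0 0 = (P * M * P⁻¹) 1 1) := by
  obtain ⟨P, hP⟩ := SL2C.exists_conj_upper_triangular M
  by_cases hne : (P * M * P⁻¹) 0 0 = (P * M * P⁻¹) 1 1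
  · exact ⟨P, hP, Or.inr hne⟩
  set D : SL2C := P * M * P⁻¹ with hD
  have hsub : D 0 0 - D 1 1 ≠ 0 := sub_ne_zero.mpr hne
  let Q : SL2C := ⟨!![1, D 0 1 / (D 0 0 - D 1 1); 0, 1], by simp [Matrix.det_fin_two_of]⟩
  have hQ : Q * P * M * (Q * P)⁻¹ = Q * D * Q⁻¹ := by
    rw [hD]
    group
  refine ⟨Q * P, ?_, Or.inl ?_⟩
  · rw [hQ, SL2C.conj_apply_one_zero]
    simp [Q, hP]
  · rw [hQ, SL2C.conj_apply_zero_one]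
    simp [Q, hP]
    field_simp
    ring

/-- The entrywise equations expressing that two `2 × 2` matrices commute. -/
theorem SL2C.entries_of_commute {D N : SL2C} (h : Commute D N) :
    D 0 1 * N 1 0 = N 0 1 * D 1 0 ∧
      D 0 0 * N 0 1 + D 0 1 * N 1 1 = N 0 0 * D 0 1 + N 0 1 * D 1 1 ∧
      D 1 0 * N 0 0 + D 1 1 * N 1 0 = N 1 0 * D 0 0 + N 1 1 * D 1 0 := by
  have hij : ∀ i j, (D * N) i j = (N * D) i j := fun i j => by rw [h.eq]
  have h00 := hij 0 0
  have h01 := hij 0 1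
  have h10 := hij 1 0
  simp only [Matrix.SpecialLinearGroup.coe_mul, Matrix.mul_apply, Fin.sum_univ_two]
    at h00 h01 h10
  exact ⟨by linear_combination h00, h01, h10⟩


/-- Every commutative torsion-free subgroup of `PSL(2,ℂ)` is conjugate either into
the image of the diagonal subgroup of `SL(2,ℂ)` or into the image of the upper
unitriangular subgroup `{[[1,b],[0,1]] : b ∈ ℂ}`. -/
theorem commutative_torsionFree_subgroup_conjugate_diagonal_or_unitriangular
    (Γ : Subgroup PSL2C)
    (hcomm : ∀ a ∈ Γ, ∀ b ∈ Γ, a * b = b * a)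
    (htf : ∀ g ∈ Γ, g ≠ 1 → ¬ IsOfFinOrder g) :
    ∃ C : PSL2C,
      (∀ g ∈ Γ, ∃ A : SL2C,
        ((A : Matrix (Fin 2) (Fin 2) ℂ) 0 1 = 0 ∧
          (A : Matrix (Fin 2) (Fin 2) ℂ) 1 0 = 0) ∧
        (QuotientGroup.mk A : PSL2C) = C * g * C⁻¹) ∨
      (∀ g ∈ Γ, ∃ A : SL2C,
        ((A : Matrix (Fin 2) (Fin 2) ℂ) 0 0 = 1 ∧
          (A : Matrix (Fin 2) (Fin 2) ℂ) 1 0 = 0 ∧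
          (A : Matrix (Fin 2) (Fin 2) ℂ) 1 1 = 1) ∧
        (QuotientGroup.mk A : PSL2C) = C * g * C⁻¹) := by
  by_cases htriv : ∀ g ∈ Γ, g = 1
  · refine ⟨1, Or.inl fun g hg => ⟨1, ⟨by simp, by simp⟩, ?_⟩⟩
    rw [htriv g hg]
    simp
  push Not at htriv
  obtain ⟨m, hm, hm1⟩ := htriv
  obtain ⟨M, rfl⟩ := QuotientGroup.mk_surjective m
  obtain ⟨P, h10, hP⟩ := SL2C.exists_conj_diagonal_or_parabolic M
  have hcommD : ∀ N : SL2C, (QuotientGroup.mk N : PSL2C) ∈ Γ →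
      Commute (P * M * P⁻¹) (P * N * P⁻¹) := fun N hN =>
    (SL2C.commute_of_commute_mk (hcomm _ hm _ hN) (htf _ hm)).conj P
  have hD1 : P * M * P⁻¹ ≠ 1 ∧ P * M * P⁻¹ ≠ -1 := by
    constructor
    · intro h
      rw [conj_eq_one_iff] at h
      exact hm1 (by rw [h]; rfl)
    · intro h
      have hM : M = -1 := by
        rw [mul_inv_eq_iff_eq_mul, neg_one_mul, ← mul_neg_one] at h
        exact mul_left_cancel h
      exact hm1 (by rw [hM, SL2C.mk_neg]; rfl)
  set D : SL2C := P * M * P⁻¹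
  refine ⟨QuotientGroup.mk P, ?_⟩
  by_cases heq : D 0 0 = D 1 1
  · right
    have h01 : D 0 1 ≠ 0 := fun h =>
      (SL2C.eq_one_or_neg_one_of_scalar h h10 heq).elim hD1.1 hD1.2
    intro g hg
    obtain ⟨N, rfl⟩ := QuotientGroup.mk_surjective g
    obtain ⟨e1, e2, -⟩ := SL2C.entries_of_commute (hcommD N hg)
    have hmk : (QuotientGroup.mk (P * N * P⁻¹) : PSL2C)
      = QuotientGroup.mk P * QuotientGroup.mk N * (QuotientGroup.mk P)⁻¹ := rfl
    rw [← hmk]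
    generalize P * N * P⁻¹ = N' at e1 e2
    have n10 : N' 1 0 = 0 := by
      rw [h10, mul_zero] at e1
      exact (mul_eq_zero.mp e1).resolve_left h01
    have nd : N' 0 0 = N' 1 1 := by
      apply mul_right_cancel₀ h01
      rw [heq] at e2
      linear_combination -e2
    have hd := SL2C.det_expand N'
    have h1 : N' 1 1 ^ 2 = 1 := by
      rw [n10, nd] at hd
      linear_combination hd
    rcases sq_eq_one_iff.mp h1 with h1 | h1
    · exact ⟨N', ⟨nd.trans h1, n10, h1⟩, rfl⟩
    · exact ⟨-N', ⟨by simp [nd, h1], by simp [n10], by simp [h1]⟩, SL2C.mk_neg N'⟩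
  · left
    have h01 : D 0 1 = 0 := hP.resolve_right heq
    have hsub : D 0 0 - D 1 1 ≠ 0 := sub_ne_zero.mpr heq
    intro g hg
    obtain ⟨N, rfl⟩ := QuotientGroup.mk_surjective g
    obtain ⟨-, e2, e3⟩ := SL2C.entries_of_commute (hcommD N hg)
    refine ⟨P * N * P⁻¹, ⟨?_, ?_⟩, rfl⟩
    · apply (mul_eq_zero.mp _).resolve_left hsub
      rw [h01] at e2
      linear_combination e2
    · apply (mul_eq_zero.mp _).resolve_left hsub
      rw [h10] at e3
      linear_combination -e3
end

section
/- Let p and q be integers with p ≥ 2 and q ≥ 2, and let G = ⟨a, b | aᵖ = b^q⟩ be the group presented by two generators a, b and the single relation aᵖ b^{−q}. Then the element aᵖ has infinite order in G, and the center of G is exactly the (infinite cyclic) subgroup generated by aᵖ. -/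
/-- The free product of at least two nontrivial groups has trivial center. -/
theorem Monoid.CoprodI.center_eq_bot {ι : Type*} [Nontrivial ι] (M : ι → Type*)
    [∀ i, Group (M i)] [∀ i, Nontrivial (M i)] :
    Subgroup.center (Monoid.CoprodI M) = ⊥ := by
  classical
  have prod_inj : Function.Injective (Word.prod : Word M → CoprodI M) := Word.equiv.symm.injective
  refine (Subgroup.eq_bot_iff_forall _).2 fun z hz => ?_
  rw [Subgroup.mem_center_iff] at hz
  obtain ⟨w, rfl⟩ := Word.equiv.symm.surjective z
  change w.prod = 1
  change ∀ g, g * w.prod = w.prod * g at hz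
  obtain ⟨l, ne_one, chain⟩ := w
  cases l with
  | nil => rfl
  | cons s t =>
    exfalso
    obtain ⟨i, h⟩ := s
    by_cases hlast : ∀ y ∈ (⟨i, h⟩ :: t : List (Σ i, M i)).getLast?, y.1 ≠ i
    · have ht : t ≠ [] := by
        rintro rfl
        exact hlast ⟨i, h⟩ (by simp) rfl
      let w' : Word M :=
        { toList := t ++ [⟨i, h⟩]
          ne_one := fun s hs => ne_one s (by simpa [or_comm] using hs)
          chain_ne := by
            refine List.isChain_append.2 ⟨chain.tail, by simp, fun x hx y hy => ?_⟩
            obtain rfl : (⟨i, h⟩ : Σ i, M i) = y := by simpa using hy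
            exact hlast x (by rw [List.getLast?_cons_of_ne_nil ht]; exact hx) }
      have key : Word.prod ⟨⟨i, h⟩ :: t, ne_one, chain⟩ = w'.prod := by
        have := hz (of h)
        simp only [Word.prod, List.map_cons, List.prod_cons, mul_assoc, mul_right_inj] at this
        simpa [Word.prod, w'] using this
      have := congrArg Word.toList (prod_inj key)
      obtain ⟨x, t', rfl⟩ := List.exists_cons_of_ne_nil ht
      obtain ⟨rfl, -⟩ := List.cons_eq_cons.1 this
      exact (List.isChain_cons_cons.1 chain).1 rfl
    · push Not at hlast
      obtain ⟨y, hy, hyi⟩ := hlast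
      obtain ⟨k, hk⟩ := exists_ne i
      obtain ⟨x, hx⟩ := exists_ne (1 : M k)
      let w₁ : Word M :=
        { toList := ⟨k, x⟩ :: ⟨i, h⟩ :: t
          ne_one := fun s hs => by
            rcases List.mem_cons.1 hs with rfl | hs
            exacts [hx, ne_one s hs]
          chain_ne := List.isChain_cons_cons.2 ⟨hk, chain⟩ }
      let w₂ : Word M :=
        { toList := (⟨i, h⟩ :: t) ++ [⟨k, x⟩]
          ne_one := fun s hs => by
            rcases List.mem_append.1 hs with hs | hs
            · exact ne_one s hs
            · obtain rfl := List.mem_singleton.1 hs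
              exact hx
          chain_ne := by
            refine List.isChain_append.2 ⟨chain, by simp, fun u hu v hv => ?_⟩
            obtain rfl : (⟨k, x⟩ : Σ i, M i) = v := by simpa using hv
            obtain rfl := Option.mem_unique hu hy
            exact hyi ▸ hk.symm }
      have key : w₁.prod = w₂.prod := by
        simpa [Word.prod, w₁, w₂, mul_assoc] using hz (of x)
      have := congrArg Word.toList (prod_inj key)
      exact hk (congrArg Sigma.fst (List.cons_eq_cons.1 this).1)

/-- In a group generated by elements `x i` with a common central power `c = x i ^ n i`, the
center is generated by `c`, provided the group surjects onto the free product of the cyclic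
groups of orders `n i` by sending `x i` to the standard generators. -/
theorem Subgroup.center_eq_zpowers_of_toCoprodI {ι G : Type*} [Nontrivial ι] [Group G]
    (n : ι → ℕ) (hn : ∀ i, 2 ≤ n i) (x : ι → G) (c : G)
    (hx : Subgroup.closure (Set.range x) = ⊤) (hc : ∀ i, x i ^ n i = c)
    (f : G →* Monoid.CoprodI fun i => Multiplicative (ZMod (n i)))
    (hf : ∀ i, f (x i) = Monoid.CoprodI.of (M := fun i => Multiplicative (ZMod (n i))) (i := i)
      (Multiplicative.ofAdd 1)) :
    Subgroup.center G = Subgroup.zpowers c := by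
  have hcenter : c ∈ Subgroup.center G := by
    rw [← Subgroup.centralizer_univ, ← Subgroup.coe_top, ← hx, Subgroup.centralizer_closure,
      Subgroup.mem_centralizer_iff]
    rintro _ ⟨i, rfl⟩
    rw [← hc i, ← pow_succ, ← pow_succ']
  have hle : Subgroup.zpowers c ≤ Subgroup.center G := by simpa using hcenter
  refine le_antisymm (fun z hz => ?_) hle
  have : (Subgroup.zpowers c).Normal :=
    ⟨fun g hg y => by rwa [Subgroup.mem_center_iff.1 (hle hg) y, mul_inv_cancel_right]⟩
  have (i : ι) : Fact (1 < n i) := ⟨hn i⟩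
  let e (i : ι) : Multiplicative (ZMod (n i)) →* G ⧸ Subgroup.zpowers c :=
    AddMonoidHom.toMultiplicativeLeft (ZMod.lift (n i)
      ⟨zmultiplesHom (Additive (G ⧸ Subgroup.zpowers c)) (Additive.ofMul (x i : G ⧸ _)), by
        change ((x i : G ⧸ Subgroup.zpowers c) ^ (n i : ℤ)) = 1
        rw [zpow_natCast, ← QuotientGroup.mk_pow, hc, QuotientGroup.eq_one_iff]
        exact Subgroup.mem_zpowers c⟩)
  have he (i : ι) : e i (Multiplicative.ofAdd 1) = x i := by
    change Additive.toMul (ZMod.lift (n i) _ 1) = _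
    rw [← Int.cast_one, ZMod.lift_coe]
    simp
  have hcomp : (Monoid.CoprodI.lift e).comp f = QuotientGroup.mk' (Subgroup.zpowers c) := by
    refine MonoidHom.eq_of_eqOn_dense hx ?_
    rintro _ ⟨i, rfl⟩
    simp [hf, he]
  have hsurj : Function.Surjective f := by
    intro w
    induction w using Monoid.CoprodI.induction_on with
    | one => exact ⟨1, map_one f⟩
    | mul u v hu hv =>
      obtain ⟨u, rfl⟩ := hu
      obtain ⟨v, rfl⟩ := hv
      exact ⟨u * v, map_mul f u v⟩
    | of i y =>
      obtain ⟨m, hm⟩ := ZMod.intCast_surjective y.toAdd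
      refine ⟨x i ^ m, ?_⟩
      rw [map_zpow, hf, ← map_zpow, ← ofAdd_zsmul, zsmul_one, hm]
      rfl
  have hfz : f z ∈ Subgroup.center (Monoid.CoprodI fun i => Multiplicative (ZMod (n i))) := by
    rw [Subgroup.mem_center_iff] at hz ⊢
    intro g
    obtain ⟨g, rfl⟩ := hsurj g
    rw [← map_mul, hz, map_mul]
  rw [Monoid.CoprodI.center_eq_bot, Subgroup.mem_bot] at hfz
  have := DFunLike.congr_fun hcomp z
  rwa [MonoidHom.comp_apply, hfz, map_one, eq_comm, QuotientGroup.mk'_apply,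
    QuotientGroup.eq_one_iff] at this

/-- In the torus-knot-type group `G = ⟨a, b ∣ aᵖ = b^q⟩` with `p, q ≥ 2`, the element
`aᵖ` has infinite order and the center of `G` is exactly the infinite cyclic subgroup
generated by `aᵖ`. -/
theorem center_torus_knot_group (p q : ℕ) (hp : 2 ≤ p) (hq : 2 ≤ q) :
    ¬ IsOfFinOrder
      ((PresentedGroup.of 0 :
        PresentedGroup ({FreeGroup.of 0 ^ p * (FreeGroup.of 1 ^ q)⁻¹} :
          Set (FreeGroup (Fin 2)))) ^ p) ∧
    Subgroup.center
      (PresentedGroup ({FreeGroup.of 0 ^ p * (FreeGroup.of 1 ^ q)⁻¹} :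
        Set (FreeGroup (Fin 2)))) =
    Subgroup.zpowers ((PresentedGroup.of 0) ^ p) := by
  set G := PresentedGroup ({FreeGroup.of 0 ^ p * (FreeGroup.of 1 ^ q)⁻¹} :
    Set (FreeGroup (Fin 2)))
  have rel : (PresentedGroup.of 0 : G) ^ p = (PresentedGroup.of 1 : G) ^ q := by
    rw [← mul_inv_eq_one]
    exact PresentedGroup.one_of_mem (Set.mem_singleton _)
  constructor
  · let φ : G →* Multiplicative ℤ :=
      PresentedGroup.toGroup (f := ![Multiplicative.ofAdd (q : ℤ), Multiplicative.ofAdd (p : ℤ)])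
        (by
          rintro _ rfl
          rw [map_mul, map_inv, map_pow, map_pow, FreeGroup.lift_apply_of,
            FreeGroup.lift_apply_of]
          refine mul_inv_eq_one.2 (Multiplicative.toAdd.injective ?_)
          simp [mul_comm])
    intro h
    obtain ⟨m, hm, h⟩ := isOfFinOrder_iff_pow_eq_one.1 (φ.isOfFinOrder h)
    rw [map_pow, PresentedGroup.toGroup.of] at h
    have := congrArg Multiplicative.toAdd h
    simp at this
    omega
  · let y (i : Fin 2) : Monoid.CoprodI fun i => Multiplicative (ZMod (![p, q] i)) :=
      Monoid.CoprodI.of (M := fun i => Multiplicative (ZMod (![p, q] i))) (i := i)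
        (Multiplicative.ofAdd 1)
    have hy (i : Fin 2) : y i ^ ![p, q] i = 1 := by
      rw [← map_pow, ← ofAdd_nsmul, nsmul_one, ZMod.natCast_self, ofAdd_zero, map_one]
    let f : G →* Monoid.CoprodI fun i => Multiplicative (ZMod (![p, q] i)) :=
      PresentedGroup.toGroup (f := y) (by
          rintro _ rfl
          rw [map_mul, map_inv, map_pow, map_pow, FreeGroup.lift_apply_of,
            FreeGroup.lift_apply_of]
          exact mul_inv_eq_one.2 ((hy 0).trans (hy 1).symm))
    exact Subgroup.center_eq_zpowers_of_toCoprodI ![p, q] (Fin.forall_fin_two.2 ⟨hp, hq⟩)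
      PresentedGroup.of _ (PresentedGroup.closure_range_of _)
      (Fin.forall_fin_two.2 ⟨rfl, rel.symm⟩) f fun i => PresentedGroup.toGroup.of _
end

section
/- Let G be a group and let ρ₁, ρ₂ : G → SL(2,ℂ) be group homomorphisms. Suppose ρ₁ is irreducible, i.e., the only ℂ-linear subspaces W of ℂ² with ρ₁(g)·W ⊆ W for all g ∈ G are W = 0 and W = ℂ². If tr ρ₁(g) = tr ρ₂(g) for every g ∈ G (the two representations have the same character), then ρ₂ is conjugate to ρ₁: there exists an invertible 2×2 complex matrix C such that ρ₂(g) = C ρ₁(g) C^{−1} for all g ∈ G. -/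
/-- **Burnside's theorem** on matrix algebras: over an algebraically closed field, a subalgebra of
`End K V` without nontrivial invariant subspaces is everything. -/
theorem Subalgebra.eq_top_of_forall_invariant {K V : Type*} [Field K] [IsAlgClosed K]
    [AddCommGroup V] [Module K V] [FiniteDimensional K V] [Nontrivial V]
    (S : Subalgebra K (Module.End K V))
    (h : ∀ W : Submodule K V, (∀ s ∈ S, ∀ v ∈ W, s v ∈ W) → W = ⊥ ∨ W = ⊤) : S = ⊤ := by
  have : IsSimpleModule S V :=
    { eq_bot_or_eq_top := fun W ↦ by
        have hW := h (W.restrictScalars K) fun s hs v hv ↦ W.smul_mem ⟨s, hs⟩ hv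
        simpa using hW }
  have hend := IsSimpleModule.algebraMap_end_bijective_of_isAlgClosed K (A := S) (V := V)
  refine eq_top_iff.2 fun f _ ↦ ?_
  let F : Module.End (Module.End S V) V :=
    { f with
      map_smul' := fun c v ↦ by
        obtain ⟨t, rfl⟩ := hend.2 c
        simp }
  obtain ⟨s, hs⟩ := Module.finite_def.1 (inferInstance : Module.Finite K V)
  obtain ⟨r, hr⟩ := jacobson_density (R := S) F s
  have hfr : f = r := LinearMap.ext_on hs fun m hm ↦ hr m hm
  exact hfr ▸ r.2

/-- If `φ` is onto the matrix algebra and `ψ` has the same trace, then the kernel of `ψ` is contained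
in that of `φ`. -/
theorem Matrix.eq_zero_of_trace_eq {K A n : Type*} [Field K] [Ring A] [Algebra K A]
    [Fintype n] [DecidableEq n] {φ ψ : A →ₐ[K] Matrix n n K} (hφ : Function.Surjective φ)
    (h : ∀ a, (φ a).trace = (ψ a).trace) {a : A} (ha : ψ a = 0) : φ a = 0 := by
  refine Matrix.ext_iff_trace_mul_right.2 fun x ↦ ?_
  obtain ⟨b, rfl⟩ := hφ x
  rw [← map_mul, h, map_mul, ha]
  simp

/-- If `φ` is onto the matrix algebra and `ψ` has the same trace, then `ψ` is conjugate to `φ`. -/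
theorem Matrix.exists_conj_of_trace_eq {K A n : Type*} [Field K] [Ring A] [Algebra K A]
    [Fintype n] [DecidableEq n] {φ ψ : A →ₐ[K] Matrix n n K} (hφ : Function.Surjective φ)
    (h : ∀ a, (φ a).trace = (ψ a).trace) :
    ∃ C : Matrix n n K, IsUnit C.det ∧ ∀ a, ψ a = C * φ a * C⁻¹ := by
  have hker : ψ.toLinearMap.ker ≤ φ.toLinearMap.ker := fun a ha ↦
    Matrix.eq_zero_of_trace_eq hφ h ha
  have hψ : Function.Surjective ψ := by
    let g : ψ.toLinearMap.range →ₗ[K] Matrix n n K :=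
      (ψ.toLinearMap.ker.liftQ φ.toLinearMap hker) ∘ₗ
        ψ.toLinearMap.quotKerEquivRange.symm.toLinearMap
    have hg : Function.Surjective g := by
      intro x
      obtain ⟨a, rfl⟩ := hφ x
      refine ⟨ψ.toLinearMap.quotKerEquivRange (Submodule.Quotient.mk a), ?_⟩
      simp [g]
    have := LinearMap.finrank_le_finrank_of_surjective hg
    exact LinearMap.range_eq_top.1 (Submodule.eq_top_of_finrank_eq
      (le_antisymm (Submodule.finrank_le _) this))
  have hker' : RingHom.ker φ = RingHom.ker ψ := by
    ext a
    exact ⟨Matrix.eq_zero_of_trace_eq hψ fun a ↦ (h a).symm, Matrix.eq_zero_of_trace_eq hφ h⟩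
  let e : Matrix n n K ≃ₐ[K] Matrix n n K :=
    (Ideal.quotientKerAlgEquivOfSurjective hφ).symm.trans
      ((Ideal.quotientEquivAlgOfEq K hker').trans (Ideal.quotientKerAlgEquivOfSurjective hψ))
  have he : ∀ a, e (φ a) = ψ a := fun a ↦ by
    have : (Ideal.quotientKerAlgEquivOfSurjective hφ).symm (φ a) =
        Ideal.Quotient.mk _ a := by
      rw [AlgEquiv.symm_apply_eq]; rfl
    simp only [e, AlgEquiv.trans_apply, this]
    rfl
  obtain ⟨T, hT⟩ := AlgEquiv.eq_linearEquivConjAlgEquiv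
    ((Matrix.toLinAlgEquiv'.symm.trans e).trans Matrix.toLinAlgEquiv')
  have hmul : LinearMap.toMatrix' T.toLinearMap * LinearMap.toMatrix' T.symm.toLinearMap = 1 := by
    rw [← LinearMap.toMatrix'_comp]; simp
  refine ⟨LinearMap.toMatrix' T.toLinearMap, Matrix.isUnit_det_of_right_inverse hmul, fun a ↦ ?_⟩
  rw [Matrix.inv_eq_right_inv hmul]
  have hconj := congr(LinearMap.toMatrix' ($hT (Matrix.toLinAlgEquiv' (φ a))))
  have hleft : LinearMap.toMatrix' (Matrix.toLinAlgEquiv' (ψ a)) = ψ a := LinearMap.toMatrix'_toLin' _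
  have hright : LinearMap.toMatrix' (Matrix.toLinAlgEquiv' (φ a)) = φ a :=
    LinearMap.toMatrix'_toLin' _
  rw [AlgEquiv.trans_apply, AlgEquiv.trans_apply, AlgEquiv.symm_apply_apply, he, hleft,
    LinearEquiv.conjAlgEquiv_apply, LinearMap.toMatrix'_comp, LinearMap.toMatrix'_comp,
    hright] at hconj
  rw [hconj, mul_assoc]

/-- If `ρ₁, ρ₂ : G → SL(2,ℂ)` are representations with `ρ₁` irreducible (the only
subspaces of `ℂ²` invariant under all `ρ₁(g)` are `0` and `ℂ²`) and with the same
character (`tr ρ₁(g) = tr ρ₂(g)` for all `g`), then `ρ₂` is conjugate to `ρ₁` by an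
invertible complex `2 × 2` matrix. -/
theorem conj_of_irreducible_of_same_character {G : Type*} [Group G]
    (ρ₁ ρ₂ : G →* Matrix.SpecialLinearGroup (Fin 2) ℂ)
    (hirr : ∀ W : Submodule ℂ (Fin 2 → ℂ),
      (∀ g : G, ∀ v ∈ W, ((ρ₁ g : Matrix (Fin 2) (Fin 2) ℂ)).mulVec v ∈ W) →
      W = ⊥ ∨ W = ⊤)
    (hchar : ∀ g : G,
      Matrix.trace (ρ₁ g : Matrix (Fin 2) (Fin 2) ℂ) =
        Matrix.trace (ρ₂ g : Matrix (Fin 2) (Fin 2) ℂ)) :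
    ∃ C : Matrix (Fin 2) (Fin 2) ℂ, IsUnit C.det ∧
      ∀ g : G, (ρ₂ g : Matrix (Fin 2) (Fin 2) ℂ) =
        C * (ρ₁ g : Matrix (Fin 2) (Fin 2) ℂ) * C⁻¹ := by
  let mat (ρ : G →* Matrix.SpecialLinearGroup (Fin 2) ℂ) :
      MonoidAlgebra ℂ G →ₐ[ℂ] Matrix (Fin 2) (Fin 2) ℂ :=
    MonoidAlgebra.lift ℂ (Matrix (Fin 2) (Fin 2) ℂ) G
      (Matrix.SpecialLinearGroup.coeMonoidHom.comp ρ)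
  have hmat : ∀ ρ g, mat ρ (MonoidAlgebra.of ℂ G g) = ρ g := fun ρ g ↦ by
    simp [mat]
  have htr : ∀ a, (mat ρ₁ a).trace = (mat ρ₂ a).trace := fun a ↦ by
    induction a using MonoidAlgebra.induction_on with
    | of g => simpa only [hmat] using hchar g
    | add a b ha hb => simp only [map_add, Matrix.trace_add, ha, hb]
    | smul c a ha => simp only [map_smul, Matrix.trace_smul, ha]
  have hsurj : Function.Surjective (mat ρ₁) := by
    let toEnd := (Matrix.toLinAlgEquiv' (R := ℂ) (n := Fin 2)).toAlgHom.comp (mat ρ₁)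
    have htop : toEnd.range = ⊤ := Subalgebra.eq_top_of_forall_invariant _ fun W hW ↦
      hirr W fun g v hv ↦ by
        have hv' := hW _ ⟨MonoidAlgebra.of ℂ G g, rfl⟩ v hv
        change (mat ρ₁ (MonoidAlgebra.of ℂ G g)).mulVec v ∈ W at hv'
        rwa [hmat] at hv'
    intro x
    obtain ⟨a, ha⟩ := AlgHom.range_eq_top _ |>.1 htop (Matrix.toLinAlgEquiv' x)
    exact ⟨a, Matrix.toLinAlgEquiv'.injective ha⟩
  obtain ⟨C, hC, hconj⟩ := Matrix.exists_conj_of_trace_eq hsurj htr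
  exact ⟨C, hC, fun g ↦ by simpa only [hmat] using hconj (MonoidAlgebra.of ℂ G g)⟩
end
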